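/- Assume 2^ℵ₀ < 2^ℵ₁. Then every abelian group that has a Borel code and is a Whitehead group is ℵ₂-free. -/

import Mathlib

open MeasureTheory Cardinal

/-- Cantor space: `ℕ → Bool` with the product topology. Its product measurable-space
structure coincides with the Borel σ-algebra of the product topology. -/
abbrev Cantor : Type := ℕ → Bool

/-- A Borel code for an abelian group `B`: a Borel set `Bstar ⊆ Cantor`, a Borel set
`E ⊆ Cantor × Cantor` whose restriction to `Bstar × Bstar` is an equivalence relation,
and a surjection `q : Bstar → B` inducing the group structure, such that the graph of
addition is Borel. -/
structure BorelCode (B : Type*) [AddCommGroup B] where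
  Bstar : Set Cantor
  E : Set (Cantor × Cantor)
  q : Cantor → B
  borel_Bstar : MeasurableSet Bstar
  borel_E : MeasurableSet E
  refl : ∀ x ∈ Bstar, (x, x) ∈ E
  symm : ∀ x ∈ Bstar, ∀ y ∈ Bstar, (x, y) ∈ E → (y, x) ∈ E
  trans : ∀ x ∈ Bstar, ∀ y ∈ Bstar, ∀ z ∈ Bstar, (x, y) ∈ E → (y, z) ∈ E → (x, z) ∈ E
  surj : ∀ b : B, ∃ x ∈ Bstar, q x = b
  q_eq_iff : ∀ x ∈ Bstar, ∀ y ∈ Bstar, (q x = q y ↔ (x, y) ∈ E)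
  borel_add : MeasurableSet {p : Cantor × Cantor × Cantor |
    p.1 ∈ Bstar ∧ p.2.1 ∈ Bstar ∧ p.2.2 ∈ Bstar ∧ q p.1 + q p.2.1 = q p.2.2}

/-- An abelian group has a Borel code. -/
def HasBorelCode (B : Type*) [AddCommGroup B] : Prop := Nonempty (BorelCode B)

/-- An abelian group is ℵ₂-free if every subgroup of cardinality at most ℵ₁ is a free
abelian group. -/
def Aleph2Free (B : Type*) [AddCommGroup B] : Prop :=
  ∀ K : AddSubgroup B, Cardinal.mk K ≤ Cardinal.aleph 1 → Module.Free ℤ K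

/-- An abelian group `G` is a Whitehead group if for every abelian group `H` and every
surjective homomorphism `f : H → G` whose kernel is isomorphic to `ℤ`, `f` has a
right inverse which is a homomorphism (equivalently, `Ext¹(G, ℤ) = 0`). -/
def IsWhitehead (G : Type*) [AddCommGroup G] : Prop :=
  ∀ (H : Type*) [AddCommGroup H] (f : H →+ G), Function.Surjective f →
    Nonempty (f.ker ≃+ ℤ) → ∃ s : G →+ H, f.comp s = AddMonoidHom.id G

open Submodule in
/-- A submodule chain with free, independent increments has free union. -/
theorem free_iSup_of_disjoint_chain {M J : Type*} [AddCommGroup M] [LinearOrder J]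
    (C N : J → Submodule ℤ M) (N₀ : Submodule ℤ M) (hfree : ∀ j, Module.Free ℤ (C j))
    (hlt : ∀ i j, i < j → C i ≤ N j) (hN₀ : ∀ j, N₀ ≤ N j) (hdisj : ∀ j, Disjoint (C j) (N j)) :
    Module.Free ℤ ↥(⨆ j, C j) ∧ Disjoint N₀ (⨆ j, C j) := by
  classical
  have key : ∀ f : Π₀ j, C j, DFinsupp.lsum ℕ (fun j => (C j).subtype) f ∈ N₀ → f = 0 := by
    intro f hf
    by_contra hne
    have hs : f.support.Nonempty := by
      rw [Finset.nonempty_iff_ne_empty]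
      simpa using hne
    set j := f.support.max' hs with hj
    have hjm : j ∈ f.support := f.support.max'_mem hs
    have hsum : DFinsupp.lsum ℕ (fun j => (C j).subtype) f = ∑ i ∈ f.support, (f i : M) := by
      rw [DFinsupp.lsum_apply_apply, DFinsupp.sumAddHom_apply]
      rfl
    rw [hsum, ← Finset.add_sum_erase _ _ hjm] at hf
    have hrest : ∑ i ∈ f.support.erase j, (f i : M) ∈ N j := by
      refine sum_mem fun i hi => hlt i j ?_ (f i).2
      exact lt_of_le_of_ne (f.support.le_max' i (Finset.mem_of_mem_erase hi))
        (Finset.ne_of_mem_erase hi)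
    have hfj : (f j : M) ∈ N j := by
      have := sub_mem (hN₀ j hf) hrest
      simpa using this
    have h0 := Submodule.disjoint_def.1 (hdisj j) _ (f j).2 hfj
    rw [DFinsupp.mem_support_iff] at hjm
    exact hjm (Subtype.ext h0)
  have hrange := Submodule.iSup_eq_range_dfinsupp_lsum C
  constructor
  · have hinj : Function.Injective (DFinsupp.lsum ℕ (fun j => (C j).subtype)) := by
      rw [← LinearMap.ker_eq_bot, LinearMap.ker_eq_bot']
      intro f hf
      exact key f (hf ▸ zero_mem _)
    rw [hrange]
    exact Module.Free.of_equiv (LinearEquiv.ofInjective _ hinj)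
  · rw [Submodule.disjoint_def, hrange]
    rintro x hx ⟨f, rfl⟩
    rw [key f hx, map_zero]

theorem exists_free_relative_complement {M : Type*} [AddCommGroup M] (A B : Submodule ℤ M)
    (hfree : Module.Free ℤ (B.map A.mkQ)) :
    ∃ C : Submodule ℤ M, Module.Free ℤ C ∧ Disjoint C A ∧ A ⊓ B ⊔ C = B := by
  have hmem : ∀ x : B, A.mkQ x ∈ B.map A.mkQ := fun x => ⟨x, x.2, rfl⟩
  let p : B →ₗ[ℤ] B.map A.mkQ := (A.mkQ.comp B.subtype).codRestrict _ hmem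
  have hp : Function.Surjective p := by
    rintro ⟨_, x, hx, rfl⟩
    exact ⟨⟨x, hx⟩, rfl⟩
  obtain ⟨s, hs⟩ := Module.projective_lifting_property p LinearMap.id hp
  have hps : ∀ z, A.mkQ (s z : M) = z := fun z => congrArg Subtype.val (LinearMap.congr_fun hs z)
  let t : B.map A.mkQ →ₗ[ℤ] M := B.subtype.comp s
  have ht : Function.Injective t := by
    intro a b hab
    apply Subtype.ext
    rw [← hps a, ← hps b]
    exact congrArg A.mkQ hab
  refine ⟨LinearMap.range t, Module.Free.of_equiv (LinearEquiv.ofInjective t ht), ?_, ?_⟩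
  · rw [Submodule.disjoint_def]
    rintro _ ⟨z, rfl⟩ hz
    have : A.mkQ (s z : M) = 0 := by
      rw [Submodule.mkQ_apply, Submodule.Quotient.mk_eq_zero]; exact hz
    rw [hps] at this
    have hz0 : z = 0 := Subtype.ext this
    rw [hz0, map_zero]
  · apply le_antisymm
    · refine sup_le inf_le_right ?_
      rintro _ ⟨z, rfl⟩
      exact (s z).2
    · intro x hx
      let z : B.map A.mkQ := ⟨A.mkQ x, hmem ⟨x, hx⟩⟩
      rw [Submodule.mem_sup]
      refine ⟨x - s z, ⟨?_, sub_mem hx (s z).2⟩, t z, ⟨z, rfl⟩, by simp [t]⟩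
      have : A.mkQ (x - s z) = 0 := by rw [map_sub, hps]; simp [z]
      rwa [Submodule.mkQ_apply, Submodule.Quotient.mk_eq_zero] at this

/-- `K` is pure in the ambient group. -/
def IsPure {G : Type*} [AddCommGroup G] (K : Submodule ℤ G) : Prop :=
  ∀ (m : ℤ) (x : G), m ≠ 0 → m • x ∈ K → x ∈ K

/-- The subgroup of all elements having a nonzero multiple in `K`. -/
def pureClosure {G : Type*} [AddCommGroup G] (K : Submodule ℤ G) : Submodule ℤ G where
  carrier := {x | ∃ m : ℤ, m ≠ 0 ∧ m • x ∈ K}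
  zero_mem' := ⟨1, one_ne_zero, by simp⟩
  add_mem' := by
    rintro x y ⟨m, hm, hx⟩ ⟨n, hn, hy⟩
    refine ⟨m * n, mul_ne_zero hm hn, ?_⟩
    rw [smul_add]
    refine add_mem ?_ ?_
    · rw [mul_comm, mul_smul]; exact K.smul_mem _ hx
    · rw [mul_smul]; exact K.smul_mem _ hy
  smul_mem' := by
    rintro c x ⟨m, hm, hx⟩
    refine ⟨m, hm, ?_⟩
    rw [smul_comm]; exact K.smul_mem _ hx

theorem mem_pureClosure {G : Type*} [AddCommGroup G] {K : Submodule ℤ G} {x : G} :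
    x ∈ pureClosure K ↔ ∃ m : ℤ, m ≠ 0 ∧ m • x ∈ K := Iff.rfl

theorem le_pureClosure {G : Type*} [AddCommGroup G] (K : Submodule ℤ G) : K ≤ pureClosure K :=
  fun x hx => ⟨1, one_ne_zero, by simpa using hx⟩

theorem pureClosure_mono {G : Type*} [AddCommGroup G] {K L : Submodule ℤ G} (h : K ≤ L) :
    pureClosure K ≤ pureClosure L := fun _ ⟨m, hm, hx⟩ => ⟨m, hm, h hx⟩

theorem isPure_pureClosure {G : Type*} [AddCommGroup G] (K : Submodule ℤ G) :
    IsPure (pureClosure K) := by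
  rintro m x hm ⟨n, hn, hx⟩
  exact ⟨n * m, mul_ne_zero hn hm, by rwa [mul_smul]⟩

theorem IsPure.pureClosure_eq {G : Type*} [AddCommGroup G] {K : Submodule ℤ G} (h : IsPure K) :
    pureClosure K = K :=
  le_antisymm (fun x ⟨m, hm, hx⟩ => h m x hm hx) (le_pureClosure K)

theorem countable_pureClosure {G : Type*} [AddCommGroup G] [Module.IsTorsionFree ℤ G]
    {K : Submodule ℤ G} (hK : (K : Set G).Countable) : (pureClosure K : Set G).Countable := by
  have : (pureClosure K : Set G) = ⋃ m : {m : ℤ // m ≠ 0}, (fun x : G => m.1 • x) ⁻¹' K := by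
    ext x
    simp [mem_pureClosure]
  rw [this]
  exact Set.countable_iUnion fun m => hK.preimage_of_injOn
    (smul_right_injective G m.2).injOn

/-- The sequence `y` witnesses that a finite rank subgroup over `K` is not finitely generated
over `K`. -/
def IsBadSeq {G : Type*} [AddCommGroup G] (K : Submodule ℤ G) (k : ℕ) (y : ℕ → G) : Prop :=
  (∀ n, ∃ m : ℤ, m ≠ 0 ∧ m • y n ∈ K ⊔ Submodule.span ℤ (y '' Set.Iio k)) ∧
    ∀ n, k ≤ n → y n ∉ K ⊔ Submodule.span ℤ (y '' Set.Iio n)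

/-- Some finite rank subgroup over `K` is not finitely generated over `K`. -/
def IsBad {G : Type*} [AddCommGroup G] (K : Submodule ℤ G) : Prop :=
  ∃ k y, IsBadSeq K k y

theorem exists_fg_of_not_isBad {G : Type*} [AddCommGroup G] {K : Submodule ℤ G} (hK : ¬ IsBad K)
    (a : ℕ → G) (k : ℕ) : ∃ F : Submodule ℤ G, F.FG ∧
      pureClosure (K ⊔ Submodule.span ℤ (a '' Set.Iio k)) = K ⊔ F := by
  by_contra! hno
  set P := pureClosure (K ⊔ Submodule.span ℤ (a '' Set.Iio k)) with hP
  have hstep : ∀ s : Set G, s.Finite → s ⊆ P → ∃ x ∈ P, x ∉ K ⊔ Submodule.span ℤ s := by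
    intro s hs hsP
    by_contra! hx
    refine hno _ (Submodule.fg_span hs) (le_antisymm hx (sup_le ?_ ?_))
    · exact le_sup_left.trans (le_pureClosure _)
    · exact Submodule.span_le.2 hsP
  choose! nx hnxP hnx using hstep
  let y : ℕ → G := fun n => Nat.strongRecOn n fun n ih =>
    if n < k then a n else nx (Set.range fun i : Fin n => ih i i.2)
  have hy : ∀ n, y n = if n < k then a n else nx (Set.range fun i : Fin n => y i) := by
    intro n
    simp only [y]
    rw [Nat.strongRecOn_eq]
  have hrange : ∀ n, (Set.range fun i : Fin n => y i) = y '' Set.Iio n := by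
    intro n
    ext x
    simp only [Set.mem_range, Set.mem_image, Set.mem_Iio]
    exact ⟨fun ⟨i, h⟩ => ⟨i, i.2, h⟩, fun ⟨i, h, h'⟩ => ⟨⟨i, h⟩, h'⟩⟩
  have hyP : ∀ n, y n ∈ P := by
    intro n
    induction n using Nat.strong_induction_on with
    | _ n ih =>
      rw [hy]
      split_ifs with h
      · exact le_pureClosure _ (Submodule.mem_sup_right (Submodule.subset_span ⟨n, h, rfl⟩))
      · refine hnxP _ (Set.finite_range _) ?_
        rintro _ ⟨i, rfl⟩
        exact ih i i.2
  have himg : y '' Set.Iio k = a '' Set.Iio k := by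
    refine Set.image_congr fun n hn => ?_
    rw [hy, if_pos (Set.mem_Iio.1 hn)]
  refine hK ⟨k, y, fun n => ?_, fun n hn => ?_⟩
  · rw [himg]
    exact hyP n
  · rw [hy n, if_neg (not_lt.2 hn), ← hrange]
    refine hnx _ (Set.finite_range _) ?_
    rintro _ ⟨i, rfl⟩
    exact hyP i

/-- **Pontryagin's criterion**, relative to a pure subgroup. -/
theorem exists_free_complement_of_not_isBad {G : Type*} [AddCommGroup G] {K : Submodule ℤ G}
    (hpure : IsPure K) (hK : ¬ IsBad K) (M : Submodule ℤ G) (hM : (M : Set G).Countable) :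
    ∃ C : Submodule ℤ G, Module.Free ℤ C ∧ Disjoint C K ∧ K ⊓ M ⊔ C = M := by
  obtain ⟨a, ha⟩ := hM.exists_eq_range ⟨0, M.zero_mem⟩
  let P : ℕ → Submodule ℤ G := fun n => pureClosure (K ⊔ Submodule.span ℤ (a '' Set.Iio n))
  have hP0 : P 0 = K := by
    simp [P, hpure.pureClosure_eq]
  have hPmono : Monotone P := fun i j hij => pureClosure_mono
    (sup_le_sup_left (Submodule.span_mono (Set.image_mono (Set.Iio_subset_Iio hij))) _)
  have hfree : ∀ n, Module.Free ℤ ((P (n + 1) ⊓ M).map (P n).mkQ) := by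
    intro n
    obtain ⟨F, hF, hPF⟩ := exists_fg_of_not_isBad hK a (n + 1)
    have hle : (P (n + 1) ⊓ M).map (P n).mkQ ≤ F.map (P n).mkQ := by
      refine (Submodule.map_mono inf_le_left).trans ?_
      rw [show P (n + 1) = K ⊔ F from hPF, Submodule.map_sup]
      refine sup_le ?_ le_rfl
      have : K ≤ P n := hP0 ▸ hPmono (Nat.zero_le n)
      rintro _ ⟨x, hx, rfl⟩
      have : (P n).mkQ x = 0 := by
        rw [Submodule.mkQ_apply, Submodule.Quotient.mk_eq_zero]; exact this hx
      rw [this]; exact zero_mem _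
    have hfg : ((P (n + 1) ⊓ M).map (P n).mkQ).FG := by
      have : IsNoetherian ℤ (F.map (P n).mkQ) :=
        isNoetherian_of_fg_of_noetherian _ (hF.map _)
      exact isNoetherian_submodule.1 this _ hle
    have : Module.Finite ℤ ((P (n + 1) ⊓ M).map (P n).mkQ) := Module.Finite.of_fg hfg
    have : Module.IsTorsionFree ℤ ((P (n + 1) ⊓ M).map (P n).mkQ) := by
      refine .of_smul_eq_zero ?_
      rintro m ⟨_, x, hx, rfl⟩ h
      by_contra! hne
      refine hne.2 (Subtype.ext ?_)
      have h' : (P n).mkQ (m • x) = 0 := by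
        rw [map_smul]; exact congrArg Subtype.val h
      rw [Submodule.mkQ_apply, Submodule.Quotient.mk_eq_zero] at h'
      simpa using isPure_pureClosure _ m x hne.1 h'
    exact Module.free_of_finite_type_torsion_free'
  choose C hCfree hCdisj hCsup using fun n =>
    exists_free_relative_complement (P n) (P (n + 1) ⊓ M) (hfree n)
  have hPM : ∀ n, P n ⊓ M = (K ⊓ M) ⊔ ⨆ i : Fin n, C i := by
    intro n
    induction n with
    | zero => simp [hP0]
    | succ n ih =>
      rw [← hCsup n, ← inf_assoc, inf_eq_left.2 (hPmono n.le_succ), ih, sup_assoc]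
      congr 1
      apply le_antisymm
      · refine sup_le (iSup_le fun i => le_iSup (fun i : Fin (n + 1) => C i) i.castSucc)
          (le_iSup (fun i : Fin (n + 1) => C i) (Fin.last n))
      · refine iSup_le fun i => ?_
        rcases Nat.lt_succ_iff_lt_or_eq.1 i.2 with h | h
        · exact (le_iSup (fun i : Fin n => C i) ⟨i, h⟩).trans le_sup_left
        · rw [h]; exact le_sup_right
  have hCP : ∀ i j, i < j → C i ≤ P j := fun i j hij =>
    ((le_sup_right.trans (hCsup i).le).trans inf_le_left).trans (hPmono hij)
  have hmain := free_iSup_of_disjoint_chain C P K hCfree hCP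
    (fun j => hP0 ▸ hPmono (Nat.zero_le j)) hCdisj
  refine ⟨⨆ n, C n, hmain.1, hmain.2.symm, le_antisymm ?_ fun x hx => ?_⟩
  · exact sup_le inf_le_right (iSup_le fun i => (le_sup_right.trans (hCsup i).le).trans inf_le_right)
  · obtain ⟨n, rfl⟩ : x ∈ Set.range a := ha ▸ hx
    have hxP : a n ∈ P (n + 1) ⊓ M := ⟨le_pureClosure _ (Submodule.mem_sup_right
      (Submodule.subset_span ⟨n, Nat.lt_succ_self n, rfl⟩)), hx⟩
    rw [hPM] at hxP
    exact sup_le_sup_left (iSup_le fun i : Fin (n + 1) => le_iSup C i) _ hxP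

/-- A partial extension problem along a chain of submodules is solvable when the target is
divisible. -/
theorem exists_linearMap_eqOn_chain {G D ι : Type*} [AddCommGroup G] [AddCommGroup D]
    (hD : Module.Baer ℤ D) [LinearOrder ι] (K : ι → Submodule ℤ G) (hK : Monotone K)
    (Y : ι → G →ₗ[ℤ] D) (hY : ∀ i j, i ≤ j → ∀ x ∈ K i, Y j x = Y i x) :
    ∃ X : G →ₗ[ℤ] D, ∀ i, ∀ x ∈ K i, X x = Y i x := by
  cases isEmpty_or_nonempty ι with
  | inl h => exact ⟨0, fun i => isEmptyElim i⟩
  | inr h =>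
    have hmem : ∀ x : ↥(⨆ i, K i), ∃ i, (x : G) ∈ K i := fun x =>
      (Submodule.mem_iSup_of_directed K hK.directed_le).1 x.2
    choose r hr using hmem
    have hval : ∀ (x : ↥(⨆ i, K i)) i, (x : G) ∈ K i → Y (r x) x = Y i x := by
      intro x i hi
      rcases le_total i (r x) with h | h
      · exact hY _ _ h _ hi
      · exact (hY _ _ h _ (hr x)).symm
    let g : ↥(⨆ i, K i) →ₗ[ℤ] D :=
      { toFun := fun x => Y (r x) x
        map_add' := by
          intro x y
          have hx : (x : G) ∈ K (max (r x) (r y)) := hK (le_max_left _ _) (hr x)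
          have hy : (y : G) ∈ K (max (r x) (r y)) := hK (le_max_right _ _) (hr y)
          rw [hval x _ hx, hval y _ hy, hval (x + y) _ (add_mem hx hy)]
          simp
        map_smul' := by
          intro c x
          rw [hval (c • x) (r x) (Submodule.smul_mem _ _ (hr x))]
          simp }
    obtain ⟨X, hX⟩ := hD.extension_property (⨆ i, K i).subtype
      (Submodule.injective_subtype _) g
    refine ⟨X, fun i x hx => ?_⟩
    have hx' : x ∈ ⨆ i, K i := Submodule.mem_iSup_of_mem i hx
    have := LinearMap.congr_fun hX ⟨x, hx'⟩
    exact this.trans (hval ⟨x, hx'⟩ i hx)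

section Approximation

variable {G D J : Type*} [AddCommGroup G] [AddCommGroup D] [LinearOrder J] [WellFoundedLT J]

/-- Homomorphisms chosen by recursion: at stage `α` we choose one which, for all `β < α`, agrees
on `K' β` with the earlier choice at `β` modified by `m β`. -/
noncomputable def approx (K' : J → Submodule ℤ G) (m : J → (G →ₗ[ℤ] D) → (G →ₗ[ℤ] D)) :
    J → G →ₗ[ℤ] D :=
  (wellFounded_lt (α := J)).fix fun α rec =>
    Classical.epsilon fun X => ∀ β (h : β < α), ∀ x ∈ K' β, X x = (rec β h + m β (rec β h)) x

theorem approx_eq (K' : J → Submodule ℤ G) (m : J → (G →ₗ[ℤ] D) → (G →ₗ[ℤ] D)) (α : J) :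
    approx K' m α = Classical.epsilon fun X : G →ₗ[ℤ] D => ∀ β < α, ∀ x ∈ K' β,
      X x = (approx K' m β + m β (approx K' m β)) x := by
  unfold approx
  rw [WellFounded.fix_eq]

theorem approx_congr (K' : J → Submodule ℤ G) {m m' : J → (G →ₗ[ℤ] D) → (G →ₗ[ℤ] D)} (α : J)
    (h : ∀ β < α, m β = m' β) : approx K' m α = approx K' m' α := by
  induction α using WellFoundedLT.induction with
  | _ α ih =>
    rw [approx_eq, approx_eq]
    congr 1
    ext X
    refine forall_congr' fun β => forall_congr' fun hβ => ?_
    rw [ih β hβ fun γ hγ => h γ (hγ.trans hβ), h β hβ]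

variable (hD : Module.Baer ℤ D) {K K' : J → Submodule ℤ G} (hKK' : ∀ α, K α ≤ K' α)
  (hK'K : ∀ α β, α < β → K' α ≤ K β) {m : J → (G →ₗ[ℤ] D) → (G →ₗ[ℤ] D)}
  (hm : ∀ α Y, ∀ x ∈ K α, m α Y x = 0)
include hD hKK' hK'K hm

theorem approx_spec (α : J) : ∀ β < α, ∀ x ∈ K' β,
    approx K' m α x = (approx K' m β + m β (approx K' m β)) x := by
  induction α using WellFoundedLT.induction with
  | _ α ih =>
    have hmono : Monotone fun β : Set.Iio α => K' β := by
      intro β γ h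
      rcases h.eq_or_lt with h | h
      · rw [h]
      · exact (hK'K _ _ h).trans (hKK' _)
    obtain ⟨X, hX⟩ := exists_linearMap_eqOn_chain hD (fun β : Set.Iio α => K' β) hmono
      (fun β => approx K' m β + m β (approx K' m β)) (by
        intro β γ h x hx
        rcases h.eq_or_lt with h | h
        · rw [h]
        · have := hm γ (approx K' m γ) x (hK'K _ _ h hx)
          rw [LinearMap.add_apply, this, add_zero]
          exact ih γ γ.2 β h x hx)
    have := Classical.epsilon_spec (p := fun X : G →ₗ[ℤ] D => ∀ β < α, ∀ x ∈ K' β,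
      X x = (approx K' m β + m β (approx K' m β)) x) ⟨X, fun β hβ => hX ⟨β, hβ⟩⟩
    rwa [← approx_eq] at this

theorem exists_limit_approx : ∃ X : G →ₗ[ℤ] D, ∀ α, ∀ x ∈ K' α,
    X x = (approx K' m α + m α (approx K' m α)) x := by
  have hmono : Monotone K' := by
    intro β γ h
    rcases h.eq_or_lt with h | h
    · rw [h]
    · exact (hK'K _ _ h).trans (hKK' _)
  refine exists_linearMap_eqOn_chain hD K' hmono _ fun β γ h x hx => ?_
  rcases h.eq_or_lt with h | h
  · rw [h]
  · have := hm γ (approx K' m γ) x (hK'K _ _ h hx)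
    rw [LinearMap.add_apply, this, add_zero]
    exact approx_spec hD hKK' hK'K hm γ β h x hx

end Approximation

theorem baer_addCircle_rat : Module.Baer ℤ (AddCircle (1 : ℚ)) := Module.Baer.of_divisible _

/-- **Stein's theorem** in lifting form: a bad sequence produces a character without a rational
lift. -/
theorem exists_character_no_lift {A : Type*} [AddCommGroup A] {k : ℕ} {y : ℕ → A}
    (hy : IsBadSeq ⊥ k y) : ∃ θ : A →ₗ[ℤ] AddCircle (1 : ℚ), ¬ ∃ ψ : A →ₗ[ℤ] ℚ,
      ∀ n, (ψ (y n) : AddCircle (1 : ℚ)) = θ (y n) := by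
  classical
  obtain ⟨htor, hnot⟩ := hy
  simp only [bot_sup_eq] at htor hnot
  let P : ℕ → Submodule ℤ A := fun n => Submodule.span ℤ (y '' Set.Iio (k + n))
  have hPmono : Monotone P := fun i j hij =>
    Submodule.span_mono (Set.image_mono (Set.Iio_subset_Iio (by omega)))
  have hρ : ∀ n, ∃ ρ : A →ₗ[ℤ] AddCircle (1 : ℚ), (∀ x ∈ P n, ρ x = 0) ∧ ρ (y (k + n)) ≠ 0 := by
    intro n
    have hne : (P n).mkQ (y (k + n)) ≠ 0 := by
      rw [Submodule.mkQ_apply, Ne, Submodule.Quotient.mk_eq_zero]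
      exact hnot _ (Nat.le_add_right k n)
    obtain ⟨c, hc⟩ := CharacterModule.exists_character_apply_ne_zero_of_ne_zero hne
    let c' : (A ⧸ P n) →+ AddCircle (1 : ℚ) := c
    refine ⟨c'.toIntLinearMap.comp (P n).mkQ, fun x hx => ?_, hc⟩
    have : (P n).mkQ x = 0 := by rwa [Submodule.mkQ_apply, Submodule.Quotient.mk_eq_zero]
    rw [LinearMap.comp_apply, this, map_zero]
  choose ρ hρ0 hρ1 using hρ
  obtain ⟨v, hv⟩ := exists_surjective_nat (Fin k → ℚ)
  let w : ℕ → A →ₗ[ℤ] ℚ := fun n =>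
    Classical.epsilon fun ψ => ∀ i : Fin k, ψ (y i) = v n i
  let m : ℕ → (A →ₗ[ℤ] AddCircle (1 : ℚ)) → (A →ₗ[ℤ] AddCircle (1 : ℚ)) := fun n Y =>
    if Y (y (k + n)) = (w n (y (k + n)) : ℚ) then ρ n else 0
  have hm : ∀ n Y, ∀ x ∈ P n, m n Y x = 0 := by
    intro n Y x hx
    simp only [m]
    split_ifs
    · exact hρ0 n x hx
    · rfl
  obtain ⟨θ, hθ⟩ := exists_limit_approx baer_addCircle_rat (K := P)
    (K' := fun n => P (n + 1)) (fun n => hPmono n.le_succ) (fun i j h => hPmono h) hm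
  refine ⟨θ, ?_⟩
  rintro ⟨ψ, hψ⟩
  obtain ⟨n, hn⟩ := hv fun i => ψ (y i)
  have hw : ∀ i : Fin k, w n (y i) = v n i :=
    Classical.epsilon_spec (p := fun ψ : A →ₗ[ℤ] ℚ => ∀ i : Fin k, ψ (y i) = v n i)
      ⟨ψ, fun i => (congrFun hn i).symm⟩
  have hagree : ∀ x ∈ Submodule.span ℤ (y '' Set.Iio k), w n x = ψ x := by
    intro x hx
    induction hx using Submodule.span_induction with
    | mem x hx =>
      obtain ⟨i, hi, rfl⟩ := hx
      exact (hw ⟨i, hi⟩).trans (congrFun hn ⟨i, hi⟩)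
    | zero => simp
    | add x y _ _ h₁ h₂ => simp [h₁, h₂]
    | smul c x _ h => simp [h]
  have hwψ : w n (y (k + n)) = ψ (y (k + n)) := by
    obtain ⟨c, hc, hcy⟩ := htor (k + n)
    have := hagree _ hcy
    rw [map_smul, map_smul] at this
    exact smul_right_injective ℚ hc this
  have hmem : y (k + n) ∈ P (n + 1) :=
    Submodule.subset_span ⟨k + n, by simp, rfl⟩
  have h1 := hθ n _ hmem
  rw [← hψ, ← hwψ, LinearMap.add_apply] at h1
  simp only [m] at h1
  split_ifs at h1 with h
  · rw [h] at h1
    exact hρ1 n (by simpa using h1.symm)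
  · exact h (by simpa using h1.symm)

universe u v

/-- In a small Whitehead group every character with values in `ℚ/ℤ` lifts to `ℚ`. -/
theorem IsWhitehead.exists_lift {B : Type u} [AddCommGroup B] [Small.{v} B]
    (hwh : IsWhitehead.{u, v} B) (χ : B →ₗ[ℤ] AddCircle (1 : ℚ)) :
    ∃ ψ : B →ₗ[ℤ] ℚ, ∀ x, (ψ x : AddCircle (1 : ℚ)) = χ x := by
  let π : ℚ →+ AddCircle (1 : ℚ) := QuotientAddGroup.mk' _
  let S : AddSubgroup (B × ℚ) :=
    ((χ.toAddMonoidHom.comp (AddMonoidHom.fst B ℚ)) - (π.comp (AddMonoidHom.snd B ℚ))).ker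
  have hS : ∀ p : B × ℚ, p ∈ S ↔ χ p.1 = (p.2 : AddCircle (1 : ℚ)) := by
    intro p
    rw [AddMonoidHom.mem_ker, AddMonoidHom.sub_apply, sub_eq_zero]
    rfl
  have : Small.{v} ℚ := Countable.toSmall _
  let e : Shrink.{v} S ≃+ S := Shrink.addEquiv
  let f : Shrink.{v} S →+ B := ((AddMonoidHom.fst B ℚ).comp S.subtype).comp e.toAddMonoidHom
  have hf : ∀ x, f x = (e x : B × ℚ).1 := fun x => rfl
  have hsurj : Function.Surjective f := by
    intro b
    obtain ⟨r, hr⟩ := QuotientAddGroup.mk_surjective (χ b)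
    exact ⟨e.symm ⟨(b, r), (hS _).2 hr.symm⟩, by rw [hf, e.apply_symm_apply]⟩
  let j : ℤ → f.ker := fun n => ⟨e.symm ⟨(0, (n : ℚ)), (hS _).2 (by
    simp only [map_zero]
    exact ((AddCircle.coe_eq_zero_iff (1 : ℚ)).2 ⟨n, by simp⟩).symm)⟩, by
      rw [AddMonoidHom.mem_ker, hf, e.apply_symm_apply]⟩
  have hej : ∀ n, (e (j n) : B × ℚ) = (0, (n : ℚ)) := fun n => by
    simp only [j, e.apply_symm_apply]
  have hinj : ∀ a b : f.ker, (e a : B × ℚ) = e b → a = b := fun a b h =>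
    Subtype.ext (e.injective (Subtype.ext h))
  have hker : Nonempty (f.ker ≃+ ℤ) := by
    let g : ℤ →+ f.ker := AddMonoidHom.mk' j (fun a b => hinj _ _ (by
      rw [AddSubgroup.coe_add, map_add, AddSubgroup.coe_add, hej, hej, hej]
      simp))
    have hg : Function.Bijective g := by
      constructor
      · intro a b h
        have := congrArg (fun x : f.ker => (e x : B × ℚ).2) h
        simpa [g, hej] using this
      · intro x
        have h1 : (e x : B × ℚ).1 = 0 := x.2
        have h2 := (hS _).1 (e x).2
        rw [h1, map_zero, eq_comm, AddCircle.coe_eq_zero_iff] at h2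
        obtain ⟨n, hn⟩ := h2
        refine ⟨n, hinj _ _ ((hej n).trans (Prod.ext h1.symm ?_))⟩
        simpa using hn
    exact ⟨(AddEquiv.ofBijective g hg).symm⟩
  obtain ⟨s, hs⟩ := hwh (Shrink.{v} S) f hsurj hker
  refine ⟨((((AddMonoidHom.snd B ℚ).comp S.subtype).comp e.toAddMonoidHom).comp
    s).toIntLinearMap, fun x => ?_⟩
  have h1 : (e (s x) : B × ℚ).1 = x := DFunLike.congr_fun hs x
  have h2 := (hS _).1 (e (s x)).2
  rw [h1] at h2
  exact h2.symm

theorem isTorsionFree_of_lift {B : Type*} [AddCommGroup B]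
    (hW : ∀ χ : B →ₗ[ℤ] AddCircle (1 : ℚ), ∃ ψ : B →ₗ[ℤ] ℚ,
      ∀ x, (ψ x : AddCircle (1 : ℚ)) = χ x) : Module.IsTorsionFree ℤ B := by
  refine .of_smul_eq_zero fun m x h => ?_
  by_contra! hne
  obtain ⟨c, hc⟩ := CharacterModule.exists_character_apply_ne_zero_of_ne_zero hne.2
  let c' : B →+ AddCircle (1 : ℚ) := c
  obtain ⟨ψ, hψ⟩ := hW c'.toIntLinearMap
  have h0 : ψ x = 0 := by
    have : m • ψ x = 0 := by rw [← map_smul, h, map_zero]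
    exact (smul_eq_zero.1 this).resolve_left hne.1
  apply hc
  have := hψ x
  rw [h0] at this
  exact this.symm

/-- A bad sequence over `K` produces a character vanishing on `K` with no rational lift vanishing
on `K`. -/
theorem IsBadSeq.exists_character {G : Type*} [AddCommGroup G] {K : Submodule ℤ G} {k : ℕ}
    {y : ℕ → G} (hy : IsBadSeq K k y) : ∃ θ : G →ₗ[ℤ] AddCircle (1 : ℚ), (∀ x ∈ K, θ x = 0) ∧
      ∀ ψ : G →ₗ[ℤ] ℚ, (∀ x ∈ K, ψ x = 0) → ∃ n, (ψ (y n) : AddCircle (1 : ℚ)) ≠ θ (y n) := by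
  have hmem : ∀ (x : G) (s : Set ℕ), K.mkQ x ∈ (⊥ : Submodule ℤ (G ⧸ K)) ⊔
      Submodule.span ℤ ((fun n => K.mkQ (y n)) '' s) ↔ x ∈ K ⊔ Submodule.span ℤ (y '' s) := by
    intro x s
    rw [bot_sup_eq, ← Submodule.comap_map_mkQ, Submodule.mem_comap, Submodule.map_span,
      Set.image_image]
  have hq : IsBadSeq (⊥ : Submodule ℤ (G ⧸ K)) k fun n => K.mkQ (y n) := by
    refine ⟨fun n => ?_, fun n hn => ?_⟩
    · obtain ⟨m, hm, h⟩ := hy.1 n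
      exact ⟨m, hm, by rw [← map_smul]; exact (hmem _ _).2 h⟩
    · exact fun h => hy.2 n hn ((hmem _ _).1 h)
  obtain ⟨θ, hθ⟩ := exists_character_no_lift hq
  refine ⟨θ.comp K.mkQ, fun x hx => ?_, fun ψ hψ => ?_⟩
  · have : K.mkQ x = 0 := by rwa [Submodule.mkQ_apply, Submodule.Quotient.mk_eq_zero]
    rw [LinearMap.comp_apply, this, map_zero]
  · by_contra! h
    exact hθ ⟨K.liftQ ψ hψ, h⟩

section ClosedPoints

variable {I : Type*} [LinearOrder I]

/-- Initial segments of `I` determined by `δ` which are closed under `e`. -/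
def ClosedUnder (e : I → I) (δ : I) : Prop := ∀ β < δ, e β < δ

variable [Uncountable I] (hI : ∀ α : I, (Set.Iic α).Countable)
include hI

theorem exists_strict_bound {s : Set I} (hs : s.Countable) : ∃ b, ∀ x ∈ s, x < b := by
  by_contra! h
  refine Set.not_countable_univ (α := I) ?_
  refine (hs.biUnion fun x _ => hI x).mono fun b _ => ?_
  obtain ⟨x, hx, hb⟩ := h b
  exact Set.mem_biUnion hx hb

theorem exists_bounding_function (Z : I → Set I) (hZ : ∀ β, (Z β).Countable) :
    ∃ e : I → I, ∀ β, ∀ x ∈ Z β, x < e β := by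
  choose e he using fun β => exists_strict_bound hI (hZ β)
  exact ⟨e, he⟩

theorem exists_closedUnder [WellFoundedLT I] (e : I → I) (α : I) : ∃ δ, α < δ ∧ ClosedUnder e δ := by
  obtain ⟨e', he'⟩ := exists_bounding_function hI (fun β => insert β (e '' Set.Iic β))
    fun β => ((hI β).image e).insert β
  let b : ℕ → I := fun n => e'^[n] α
  have hb : ∀ n, b (n + 1) = e' (b n) := fun n => Function.iterate_succ_apply' _ _ _
  have hne : {δ | ∀ n, b n < δ}.Nonempty := by
    obtain ⟨d, hd⟩ := exists_strict_bound hI (Set.countable_range b)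
    exact ⟨d, fun n => hd _ ⟨n, rfl⟩⟩
  obtain ⟨δ, hδ, hmin⟩ := WellFounded.has_min (wellFounded_lt (α := I)) _ hne
  refine ⟨δ, hδ 0, fun β hβ => ?_⟩
  have : ∃ n, β ≤ b n := by
    by_contra! h
    exact hmin β h hβ
  obtain ⟨n, hn⟩ := this
  have h1 : e β < b (n + 1) := hb n ▸ he' (b n) _ (Set.mem_insert_of_mem _ ⟨β, hn, rfl⟩)
  exact h1.trans (hδ _)

/-- Along an analytic condition, a set of initial segments of `ω₁` is either nonstationary or
contains a closed unbounded set. -/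
theorem analytic_dichotomy {X : Type*} [TopologicalSpace X] [T2Space X] {A : Set (ℕ → X)}
    (hA : AnalyticSet A) (u : I → X) :
    (∃ e : I → I, ∀ δ, ClosedUnder e δ →
      ¬ ∃ h : ℕ → I, Set.range h = Set.Iio δ ∧ u ∘ h ∈ A) ∨
    ∃ e : I → I, ∀ δ, ClosedUnder e δ → (Set.Iio δ).Nonempty →
      ∃ h : ℕ → I, Set.range h = Set.Iio δ ∧ u ∘ h ∈ A := by
  classical
  rw [AnalyticSet] at hA
  rcases hA with rfl | ⟨f, hf, rfl⟩
  · exact Or.inl ⟨id, fun δ _ ⟨h, _, hh⟩ => hh⟩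
  let pre : (ℕ → I × ℕ) → ℕ → List (I × ℕ) := fun g n => (List.range n).map g
  let W : I → (ℕ → I × ℕ) → Prop := fun δ g =>
    Set.range (fun i => (g i).1) = Set.Iio δ ∧ (u ∘ fun i => (g i).1) = f fun i => (g i).2
  let S : List (I × ℕ) → Set I := fun l => {δ | ∃ g, W δ g ∧ pre g l.length = l}
  let N : List (I × ℕ) → Prop := fun l => ∃ e : I → I, ∀ δ, ClosedUnder e δ → δ ∉ S l
  have hW : ∀ δ, (∃ h : ℕ → I, Set.range h = Set.Iio δ ∧ u ∘ h ∈ Set.range f) ↔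
      ∃ g, W δ g := by
    intro δ
    constructor
    · rintro ⟨h, hh, y, hy⟩
      exact ⟨fun i => (h i, y i), hh, hy.symm⟩
    · rintro ⟨g, h1, h2⟩
      exact ⟨fun i => (g i).1, h1, _, h2.symm⟩
  simp only [hW]
  by_cases hnil : N []
  · obtain ⟨e, he⟩ := hnil
    refine Or.inl ⟨e, fun δ hδ ⟨g, hg⟩ => he δ hδ ⟨g, hg, rfl⟩⟩
  right
  have hcount : ∀ β : I, {l : List (I × ℕ) | ∀ p ∈ l, p.1 ≤ β}.Countable := by
    intro β
    have : Countable (Set.Iic β) := hI β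
    refine (Set.countable_range fun l : List (Set.Iic β × ℕ) =>
      l.map fun p => (p.1.1, p.2)).mono fun l hl => ?_
    refine ⟨l.attach.map fun p => (⟨p.1.1, Set.mem_Iic.2 (hl _ p.2)⟩, p.1.2), ?_⟩
    simpa [List.map_map, Function.comp_def] using List.attach_map_subtype_val l
  have hbd : ∀ (l : List (I × ℕ)) (β₀ δ : I), β₀ < δ → (∀ p ∈ l, p.1 < δ) →
      ∃ β < δ, β₀ ≤ β ∧ ∀ p ∈ l, p.1 ≤ β := by
    intro l β₀ δ h₀ hl
    induction l with
    | nil => exact ⟨β₀, h₀, le_rfl, by simp⟩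
    | cons p l ih =>
      obtain ⟨β, hβ, hle, hall⟩ := ih fun q hq => hl q (List.mem_cons_of_mem _ hq)
      refine ⟨max β p.1, max_lt hβ (hl p List.mem_cons_self), hle.trans (le_max_left _ _), ?_⟩
      intro q hq
      rcases List.mem_cons.1 hq with rfl | hq
      · exact le_max_right _ _
      · exact (hall q hq).trans (le_max_left _ _)
  have hN : ∀ l : List (I × ℕ), ∃ e : I → I, N l → ∀ δ, ClosedUnder e δ → δ ∉ S l := by
    intro l
    by_cases h : N l
    · exact ⟨h.choose, fun _ => h.choose_spec⟩
    · exact ⟨id, fun h' => (h h').elim⟩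
  choose c hc using hN
  obtain ⟨E, hE⟩ := exists_bounding_function hI
    (fun β => ⋃ l ∈ {l : List (I × ℕ) | ∀ p ∈ l, p.1 ≤ β}, c l '' Set.Iic β)
    fun β => (hcount β).biUnion fun l _ => (hI β).image _
  have hEc : ∀ δ, ClosedUnder E δ → ∀ l : List (I × ℕ), (∀ p ∈ l, p.1 < δ) → δ ∈ S l →
      ¬ N l := by
    intro δ hδ l hl hS hNl
    refine hc l hNl δ (fun β hβ => ?_) hS
    obtain ⟨β', hβ', hle, hall⟩ := hbd l β δ hβ hl
    exact (hE β' _ (Set.mem_biUnion (x := l) hall ⟨β, hle, rfl⟩)).trans (hδ β' hβ')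
  have hpre_mem : ∀ (g : ℕ → I × ℕ) δ, W δ g → ∀ n, ∀ p ∈ pre g n, p.1 < δ := by
    intro g δ hg n p hp
    obtain ⟨i, -, rfl⟩ := List.mem_map.1 hp
    have : (g i).1 ∈ Set.Iio δ := hg.1 ▸ ⟨i, rfl⟩
    exact this
  have hpre_len : ∀ (g : ℕ → I × ℕ) n, (pre g n).length = n := fun g n => by simp [pre]
  have hext : ∀ (l : List (I × ℕ)) (x : I), ∃ l' : List (I × ℕ), ¬ N l →
      ¬ N l' ∧ l <+: l' ∧ l.length < l'.length ∧ ∃ p ∈ l', p.1 = x := by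
    intro l x
    by_cases hl : N l
    · exact ⟨[], fun h => (h hl).elim⟩
    have : ∃ δ, ClosedUnder (fun β => max (E β) (max x β)) δ ∧ δ ∈ S l ∧ x < δ := by
      by_contra! hno
      obtain ⟨α, hα⟩ := exists_strict_bound hI (Set.countable_singleton x)
      refine hl ⟨fun β => max (E β) (max x β), fun δ hδ hS => ?_⟩
      have hle := hno δ hδ hS
      obtain ⟨g, hg, -⟩ := hS
      have hmem : (g 0).1 ∈ Set.Iio δ := hg.1 ▸ ⟨0, rfl⟩
      have hlt := hδ _ hmem
      exact absurd ((le_max_left x _).trans (le_max_right _ _) |>.trans_lt hlt) hle.not_gt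
    obtain ⟨δ, hδ, ⟨g, hg, hgl⟩, hx⟩ := this
    obtain ⟨i, hi⟩ : x ∈ Set.range fun i => (g i).1 := hg.1 ▸ hx
    refine ⟨pre g (l.length + (i + 1)), fun _ => ⟨?_, ?_, ?_, ?_⟩⟩
    · refine hEc δ (fun β hβ => (le_max_left _ _).trans_lt (hδ β hβ)) _ (hpre_mem g δ hg _) ?_
      exact ⟨g, hg, by rw [hpre_len]⟩
    · conv_lhs => rw [← hgl]
      simp only [pre, List.range_add, List.map_append]
      exact List.prefix_append _ _
    · rw [hpre_len]; omega
    · exact ⟨g i, List.mem_map.2 ⟨i, List.mem_range.2 (by omega), rfl⟩, hi⟩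
  choose ext hext using hext
  obtain ⟨E', hE'⟩ := exists_bounding_function hI
    (fun β => ⋃ l ∈ {l : List (I × ℕ) | ∀ p ∈ l, p.1 ≤ β}, ⋃ x ∈ Set.Iic β,
      Prod.fst '' {p | p ∈ ext l x})
    fun β => (hcount β).biUnion fun l _ => (hI β).biUnion fun x _ =>
      (List.finite_toSet _).countable.image _
  refine ⟨E', fun δ hδ hne => ?_⟩
  have hcδ : (Set.Iio δ).Countable := (hI δ).mono Set.Iio_subset_Iic_self
  obtain ⟨x, hx⟩ := hcδ.exists_eq_range hne
  have hxδ : ∀ n, x n < δ := fun n => by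
    have : x n ∈ Set.Iio δ := hx ▸ ⟨n, rfl⟩
    exact this
  let L : ℕ → List (I × ℕ) := fun n => Nat.rec [] (fun n l => ext l (x n)) n
  have hLs : ∀ n, L (n + 1) = ext (L n) (x n) := fun n => rfl
  have hLN : ∀ n, ¬ N (L n) := by
    intro n
    induction n with
    | zero => exact hnil
    | succ n ih => rw [hLs]; exact (hext _ _ ih).1
  have hLδ : ∀ n, ∀ p ∈ L n, p.1 < δ := by
    intro n
    induction n with
    | zero => intro p hp; exact absurd hp List.not_mem_nil
    | succ n ih =>
      intro p hp
      obtain ⟨β, hβ, hle, hall⟩ := hbd (L n) (x n) δ (hxδ n) ih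
      refine (hE' β _ ?_).trans (hδ β hβ)
      exact Set.mem_biUnion (x := L n) hall (Set.mem_biUnion (x := x n) hle ⟨p, hp, rfl⟩)
  have hLpre : ∀ n m, n ≤ m → L n <+: L m := by
    intro n m h
    induction h with
    | refl => exact List.prefix_refl _
    | step _ ih => exact ih.trans (hext _ _ (hLN _)).2.1
  have hLlen : ∀ n, n ≤ (L n).length := by
    intro n
    induction n with
    | zero => exact Nat.zero_le _
    | succ n ih => exact ih.trans_lt (hext _ _ (hLN n)).2.2.1
  let g : ℕ → I × ℕ := fun i => (L (i + 1))[i]'(hLlen (i + 1))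
  have hg : ∀ n i (h : i < (L n).length), (L n)[i] = g i := by
    intro n i h
    rcases le_total n (i + 1) with hn | hn
    · exact (hLpre _ _ hn).getElem h
    · exact ((hLpre _ _ hn).getElem (hLlen (i + 1))).symm
  refine ⟨g, ?_, ?_⟩
  · ext z
    constructor
    · rintro ⟨i, rfl⟩
      exact hLδ (i + 1) _ (List.getElem_mem _)
    · intro hz
      obtain ⟨n, rfl⟩ : z ∈ Set.range x := hx ▸ hz
      obtain ⟨p, hp, hpx⟩ := (hext _ _ (hLN n)).2.2.2
      obtain ⟨i, hi, rfl⟩ := List.getElem_of_mem hp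
      exact ⟨i, (congrArg Prod.fst (hg (n + 1) i hi)).symm.trans hpx⟩
  · have hwit : ∀ n, ∃ g' δ', W δ' g' ∧ ∀ i < n, g' i = g i := by
      intro n
      have : ∃ δ', δ' ∈ S (L n) := by
        by_contra h
        exact hLN n ⟨id, fun δ' _ hS => h ⟨δ', hS⟩⟩
      obtain ⟨δ', g', hg', hpre⟩ := this
      refine ⟨g', δ', hg', fun i hi => ?_⟩
      have hi' : i < (L n).length := hi.trans_le (hLlen n)
      rw [← hg n i hi']
      have : (L n)[i] = (pre g' (L n).length)[i]'(by rwa [hpre_len]) := by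
        congr 1; exact hpre.symm
      rw [this]
      simp [pre]
    choose G' δ' hG' hagree using hwit
    have hlim : Filter.Tendsto (fun n => fun i => (G' n i).2) Filter.atTop
        (nhds fun i => (g i).2) := by
      rw [tendsto_pi_nhds]
      intro i
      refine tendsto_const_nhds.congr' ?_
      filter_upwards [Filter.eventually_gt_atTop i] with n hn
      rw [hagree n i hn]
    have hlim2 := (hf.tendsto _).comp hlim
    funext i
    have h1 := (tendsto_pi_nhds.1 hlim2) i
    refine tendsto_nhds_unique (tendsto_const_nhds.congr' ?_) h1
    filter_upwards [Filter.eventually_gt_atTop i] with n hn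
    have := congrFun (hG' n).2 i
    simp only [Function.comp_apply] at this ⊢
    rw [← this, hagree n i hn]

end ClosedPoints

section Analytic

theorem polishSpace_pi {ι X : Type*} [Countable ι] [TopologicalSpace X] [PolishSpace X] :
    PolishSpace (ι → X) := inferInstance

theorem borelSpace_pi {ι X : Type*} [Countable ι] [TopologicalSpace X] [MeasurableSpace X]
    [SecondCountableTopology X] [BorelSpace X] : BorelSpace (ι → X) := inferInstance

/-- Subgroups of the free abelian group on `(ℕ × ℕ) ⊕ ℕ` generated by the first summand and the
first `n` generators of the second one. -/
noncomputable def freeInitial (n : ℕ) : Submodule ℤ ((ℕ × ℕ) ⊕ ℕ →₀ ℤ) :=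
  Submodule.span ℤ (Set.range fun p => Finsupp.single (Sum.inl p) 1) ⊔
    Submodule.span ℤ ((fun j => Finsupp.single (Sum.inr j) 1) '' Set.Iio n)

/-- Codes `c` of generators of a subgroup, together with codes `z` of a homomorphism witnessing
that the subgroup is bad. -/
def badWitness {G : Type*} [AddCommGroup G] (code : BorelCode G) (k : ℕ) :
    Set ((ℕ → ℕ → Cantor) × (((ℕ × ℕ) ⊕ ℕ →₀ ℤ) → Cantor)) :=
  {w | (∀ n m, w.1 n m ∈ code.Bstar) ∧ (∀ a, w.2 a ∈ code.Bstar) ∧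
    (∀ a b, (w.2 a, w.2 b, w.2 (a + b)) ∈ {p : Cantor × Cantor × Cantor |
      p.1 ∈ code.Bstar ∧ p.2.1 ∈ code.Bstar ∧ p.2.2 ∈ code.Bstar ∧
        code.q p.1 + code.q p.2.1 = code.q p.2.2}) ∧
    (∀ p : ℕ × ℕ, (w.2 (Finsupp.single (Sum.inl p) 1), w.1 p.1 p.2) ∈ code.E) ∧
    (∀ n, ∃ m : {m : ℤ // m ≠ 0}, ∃ a : freeInitial k,
      (w.2 (m.1 • Finsupp.single (Sum.inr n) 1), w.2 a) ∈ code.E) ∧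
    ∀ n : {n // k ≤ n}, ∀ a : freeInitial n,
      ¬ (w.2 (Finsupp.single (Sum.inr n.1) 1), w.2 a) ∈ code.E}

theorem measurableSet_badWitness {G : Type*} [AddCommGroup G] (code : BorelCode G) (k : ℕ) :
    MeasurableSet (badWitness code k) := by
  have hz : ∀ a, Measurable fun w : (ℕ → ℕ → Cantor) × (((ℕ × ℕ) ⊕ ℕ →₀ ℤ) → Cantor) =>
      w.2 a := fun a => (measurable_pi_apply a).comp measurable_snd
  have hc : ∀ n m, Measurable fun w : (ℕ → ℕ → Cantor) × (((ℕ × ℕ) ⊕ ℕ →₀ ℤ) → Cantor) =>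
      w.1 n m := fun n m =>
    (measurable_pi_apply m).comp ((measurable_pi_apply n).comp measurable_fst)
  have h1 := code.borel_Bstar.mem
  have h2 := code.borel_E.mem
  have h3 := code.borel_add.mem
  refine measurableSet_setOfPred.2 (.and (.forall fun n => .forall fun m => h1.comp (hc n m))
    (.and (.forall fun a => h1.comp (hz a)) (.and (.forall fun a => .forall fun b => h3.comp
    ((hz a).prodMk ((hz b).prodMk (hz _)))) (.and (.forall fun p => h2.comp ((hz _).prodMk
    (hc _ _))) (.and (.forall fun n => .exists fun m => .exists fun a => h2.comp ((hz _).prodMk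
    (hz _))) (.forall fun n => .forall fun a => .not (h2.comp ((hz _).prodMk (hz _)))))))))

theorem mem_badWitness_iff {G : Type*} [AddCommGroup G] (code : BorelCode G) (k : ℕ)
    {c : ℕ → ℕ → Cantor} {z : ((ℕ × ℕ) ⊕ ℕ →₀ ℤ) → Cantor} (hc : ∀ n m, c n m ∈ code.Bstar)
    (hz : ∀ a, z a ∈ code.Bstar) (F : ((ℕ × ℕ) ⊕ ℕ →₀ ℤ) →ₗ[ℤ] G) (hF : ∀ a, code.q (z a) = F a)
    (hFc : ∀ p : ℕ × ℕ, F (Finsupp.single (Sum.inl p) 1) = code.q (c p.1 p.2)) :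
    (c, z) ∈ badWitness code k ↔
      IsBadSeq (Submodule.span ℤ (Set.range fun p : ℕ × ℕ => code.q (c p.1 p.2))) k
        fun n => F (Finsupp.single (Sum.inr n) 1) := by
  have hmap : ∀ n, Submodule.span ℤ (Set.range fun p : ℕ × ℕ => code.q (c p.1 p.2)) ⊔
      Submodule.span ℤ ((fun n => F (Finsupp.single (Sum.inr n) 1)) '' Set.Iio n) =
      (freeInitial n).map F := by
    intro n
    rw [freeInitial, Submodule.map_sup, Submodule.map_span, Submodule.map_span, Set.image_image,
      ← Set.range_comp]
    simp only [Function.comp_def, hFc]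
  have hE : ∀ a b, (z a, z b) ∈ code.E ↔ F a = F b := fun a b => by
    rw [← code.q_eq_iff _ (hz a) _ (hz b), hF, hF]
  simp only [IsBadSeq, hmap, badWitness, Set.mem_ofPred_eq, hE, Submodule.mem_map, ← map_smul]
  constructor
  · rintro ⟨-, -, -, -, h5, h6⟩
    refine ⟨fun n => ?_, fun n hn ⟨a, ha, h⟩ => h6 ⟨n, hn⟩ ⟨a, ha⟩ h.symm⟩
    obtain ⟨m, a, h⟩ := h5 n
    exact ⟨m, m.2, a, a.2, h.symm⟩
  · rintro ⟨h5, h6⟩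
    refine ⟨hc, hz, fun a b => ⟨hz _, hz _, hz _, by rw [hF, hF, hF, map_add]⟩, fun p => ?_,
      fun n => ?_, fun n a h => h6 n n.2 ⟨a, a.2, h.symm⟩⟩
    · rw [← code.q_eq_iff _ (hz _) _ (hc _ _), hF, hFc]
    · obtain ⟨m, hm, a, ha, h⟩ := h5 n
      exact ⟨⟨m, hm⟩, ⟨a, ha⟩, h.symm⟩

/-- Badness of a countable subgroup is an analytic condition on codes of its generators. -/
theorem analyticSet_isBad {G : Type*} [AddCommGroup G] (code : BorelCode G) :
    AnalyticSet {c : ℕ → ℕ → Cantor | (∀ n m, c n m ∈ code.Bstar) ∧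
      IsBad (Submodule.span ℤ (Set.range fun p : ℕ × ℕ => code.q (c p.1 p.2)))} := by
  have heq : {c : ℕ → ℕ → Cantor | (∀ n m, c n m ∈ code.Bstar) ∧
      IsBad (Submodule.span ℤ (Set.range fun p : ℕ × ℕ => code.q (c p.1 p.2)))} =
      ⋃ k, Prod.fst '' badWitness code k := by
    ext c
    simp only [Set.mem_iUnion, Set.mem_ofPred_eq]
    constructor
    · rintro ⟨hc, k, y, hy⟩
      choose s hs hq using code.surj
      let F := Finsupp.linearCombination ℤ
        (Sum.elim (fun p : ℕ × ℕ => code.q (c p.1 p.2)) y)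
      refine ⟨k, ⟨c, fun a => s (F a)⟩, (mem_badWitness_iff code k hc (fun a => hs _) F
        (fun a => hq _) fun p => by simp [F]).2 ?_, rfl⟩
      simpa [F] using hy
    · rintro ⟨k, ⟨c', z⟩, hw, rfl⟩
      obtain ⟨hc, hz, hadd, hE, -⟩ := id hw
      let f : ((ℕ × ℕ) ⊕ ℕ →₀ ℤ) →+ G :=
        AddMonoidHom.mk' (fun a => code.q (z a)) fun a b => (hadd a b).2.2.2.symm
      exact ⟨hc, k, _, (mem_badWitness_iff code k hc hz f.toIntLinearMap (fun a => rfl)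
        fun p => (code.q_eq_iff _ (hz _) _ (hc _ _)).2 (hE p)).1 hw⟩
  have : PolishSpace Cantor := polishSpace_pi
  have : PolishSpace (ℕ → Cantor) := polishSpace_pi
  have : PolishSpace (ℕ → ℕ → Cantor) := polishSpace_pi
  have : PolishSpace (((ℕ × ℕ) ⊕ ℕ →₀ ℤ) → Cantor) := polishSpace_pi
  have : BorelSpace Cantor := borelSpace_pi
  have : BorelSpace (ℕ → Cantor) := borelSpace_pi
  have : BorelSpace (ℕ → ℕ → Cantor) := borelSpace_pi
  have : BorelSpace (((ℕ × ℕ) ⊕ ℕ →₀ ℤ) → Cantor) := borelSpace_pi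
  rw [heq]
  exact .iUnion fun k => (measurableSet_badWitness code k).analyticSet.image_of_continuous
    continuous_fst

end Analytic

section Filtrations

theorem countable_span {G : Type*} [AddCommGroup G] {s : Set G} (hs : s.Countable) :
    (Submodule.span ℤ s : Set G).Countable := by
  have : Countable s := hs
  rw [Finsupp.span_eq_range_linearCombination, LinearMap.coe_range]
  exact Set.countable_range _

/-- If all complements of the `K γ` in `N` are controlled, a subgroup exhausted by a chain
is free. -/
theorem free_of_forall_not_isBad {G J : Type*} [AddCommGroup G] [LinearOrder J]
    [WellFoundedLT J] {K K' : J → Submodule ℤ G}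
    (hK'K : ∀ α β, α < β → K' α ≤ K β) (hcont : ∀ α, ∀ x ∈ K α, x = 0 ∨ ∃ β < α, x ∈ K' β)
    (hcount : ∀ α, (K' α : Set G).Countable) (hpure : ∀ α, IsPure (K α))
    (hbad : ∀ α, ¬ IsBad (K α)) (N : Submodule ℤ G) (hN : ∀ x ∈ N, ∃ α, x ∈ K' α) :
    Module.Free ℤ N := by
  choose C hfree hdisj hC using fun α =>
    exists_free_complement_of_not_isBad (hpure α) (hbad α) (N ⊓ K' α)
      ((hcount α).mono inf_le_right)
  have hCle : ∀ α, C α ≤ N ⊓ K' α := fun α => (hC α) ▸ le_sup_right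
  have hle : ∀ α, N ⊓ K' α ≤ ⨆ γ, C γ := by
    intro α
    induction α using WellFoundedLT.induction with
    | _ α ih =>
      nth_rewrite 1 [← hC α]
      refine sup_le (fun x ⟨hx, hxN, _⟩ => ?_) (le_iSup C α)
      rcases hcont α x hx with rfl | ⟨β, hβ, hxβ⟩
      · exact zero_mem _
      · exact ih β hβ ⟨hxN, hxβ⟩
  have hsup : ⨆ γ, C γ = N := by
    refine le_antisymm (iSup_le fun γ => (hCle γ).trans inf_le_left) fun x hx => ?_
    obtain ⟨α, hα⟩ := hN x hx
    exact hle α ⟨hx, hα⟩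
  rw [← hsup]
  exact (free_iSup_of_disjoint_chain C K ⊥ hfree
    (fun i j h => (hCle i).trans (inf_le_right.trans (hK'K i j h))) (fun _ => bot_le) hdisj).1

theorem exists_injective_code (X Y : Type*) [Countable X] [Countable Y] :
    ∃ c : (X → Y) → ℕ → Bool, Function.Injective c := by
  classical
  obtain ⟨i, hi⟩ := Countable.exists_injective_nat (X × Y)
  refine ⟨fun f n => decide (∃ x, i (x, f x) = n), fun f f' h => ?_⟩
  funext x
  have := congrFun h (i (x, f x))
  simp only [decide_eq_decide] at this
  obtain ⟨x', hx'⟩ := this.1 ⟨x, rfl⟩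
  have h2 := hi hx'
  simp only [Prod.mk.injEq] at h2
  obtain ⟨rfl, h3⟩ := h2
  exact h3.symm

/-- If every character of `G` lifts to `ℚ`, then a chain of countable subgroups of `G` with
characters which have no lift at any step has length `κ` with `2 ^ κ ≤ 2 ^ ℵ₀`. -/
theorem exists_injective_of_characters_no_lift {G J : Type*} [AddCommGroup G] [LinearOrder J]
    [WellFoundedLT J]
    (hW : ∀ χ : G →ₗ[ℤ] AddCircle (1 : ℚ), ∃ ψ : G →ₗ[ℤ] ℚ, ∀ x, (ψ x : AddCircle (1 : ℚ)) = χ x)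
    {K K' : J → Submodule ℤ G} (hKK' : ∀ α, K α ≤ K' α)
    (hK'K : ∀ α β, α < β → K' α ≤ K β) (K₀ : Submodule ℤ G)
    (hK₀ : (K₀ : Set G).Countable)
    (hcont : ∀ α, ∀ x ∈ K α, x ∈ K₀ ∨ ∃ β < α, x ∈ K' β)
    (hcount : ∀ α, (K' α : Set G).Countable) (θ : J → G →ₗ[ℤ] AddCircle (1 : ℚ))
    (hθK : ∀ α, ∀ x ∈ K α, θ α x = 0)
    (hθ : ∀ α, ∀ ψ : G →ₗ[ℤ] ℚ, (∀ x ∈ K α, ψ x = 0) →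
      ∃ x ∈ K' α, (ψ x : AddCircle (1 : ℚ)) ≠ θ α x) :
    ∃ F : (J → Bool) → ℕ → Bool, Function.Injective F := by
  let m : (J → Bool) → J → G →ₗ[ℤ] AddCircle (1 : ℚ) := fun g γ => if g γ then θ γ else 0
  have hm : ∀ g α (_ : G →ₗ[ℤ] AddCircle (1 : ℚ)), ∀ x ∈ K α, m g α x = 0 := by
    intro g α _ x hx
    by_cases h : g α
    · simpa [m, h] using hθK α x hx
    · simp [m, h]
  choose X hX using fun g => exists_limit_approx (m := fun γ _ => m g γ)
    baer_addCircle_rat hKK' hK'K (hm g)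
  choose Ψ hΨ using fun g => hW (X g)
  have key' : ∀ g g' γ, (∀ β < γ, g β = g' β) → (∀ x ∈ K γ, Ψ g x = Ψ g' x) →
      g γ = true → g' γ = true := by
    intro g g' γ hlt hK hg
    by_contra hg'
    obtain ⟨x, hx, hne⟩ := hθ γ (Ψ g - Ψ g') fun x hx => by
      rw [LinearMap.sub_apply, hK x hx, sub_self]
    apply hne
    rw [LinearMap.sub_apply, AddCircle.coe_sub, hΨ, hΨ, hX g γ x hx, hX g' γ x hx,
      approx_congr K' (m := fun γ _ => m g γ) (m' := fun γ _ => m g' γ) γ fun β hβ => by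
        simp only [m, hlt β hβ]]
    simp [m, hg, hg']
  have key : ∀ g g' γ, (∀ β < γ, g β = g' β) → (∀ x ∈ K γ, Ψ g x = Ψ g' x) → g γ = g' γ :=
    fun g g' γ hlt hK => Bool.eq_iff_iff.2 ⟨key' g g' γ hlt hK,
      key' g' g γ (fun β hβ => (hlt β hβ).symm) fun x hx => (hK x hx).symm⟩
  have hcode : ∀ γ, ∃ c : (K' γ × ℕ → ℚ) → ℕ → Bool, Function.Injective c := by
    intro γ
    have : Countable (K' γ) := hcount γ
    exact exists_injective_code _ _
  choose c hc using hcode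
  let P : (J → Bool) → ℕ → ℕ → J → Bool := fun g k =>
    Nat.rec (fun _ => g) (fun _ p i γ => c γ (fun x => Ψ (p x.2) x.1) i) k
  have hP : ∀ g k i γ, P g (k + 1) i γ = c γ (fun x => Ψ (P g k x.2) x.1) i :=
    fun _ _ _ _ => rfl
  have : Countable K₀ := hK₀
  obtain ⟨c₀, hc₀⟩ := exists_injective_code (ℕ × ℕ × K₀) ℚ
  refine ⟨fun g => c₀ fun x => Ψ (P g x.1 x.2.1) x.2.2, fun g g' h => ?_⟩
  have hall : ∀ γ k i, P g k i γ = P g' k i γ := by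
    intro γ
    induction γ using WellFoundedLT.induction with
    | _ γ ih =>
      intro k i
      refine key _ _ γ (fun β hβ => ih β hβ k i) fun x hx => ?_
      rcases hcont γ x hx with hx | ⟨β, hβ, hxβ⟩
      · exact congrFun (hc₀ h) (k, i, ⟨x, hx⟩)
      · have : c β (fun x => Ψ (P g k x.2) x.1) = c β (fun x => Ψ (P g' k x.2) x.1) := by
          funext j
          rw [← hP, ← hP]
          exact ih β hβ (k + 1) j
        exact congrFun (hc β this) (⟨x, hxβ⟩, i)
  funext γ
  exact hall γ 0 0

/-- The union of the proper initial segment, below `δ`, of a chain of subgroups. -/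
def initialSup {G I : Type*} [AddCommGroup G] [LinearOrder I] (T : I → Submodule ℤ G) (δ : I) :
    Submodule ℤ G :=
  ⨆ β : Set.Iio δ, T β

/-- A continuous filtration by countable pure subgroups, of length `I`, in which all bad steps are
witnessed immediately. -/
theorem exists_filtration {G I : Type*} [AddCommGroup G] [Module.IsTorsionFree ℤ G]
    [LinearOrder I] [WellFoundedLT I] (hI : ∀ α : I, (Set.Iic α).Countable) (a : I → G) :
    ∃ T : I → Submodule ℤ G, (∀ α, IsPure (T α)) ∧ (∀ α, (T α : Set G).Countable) ∧
      (∀ α, initialSup T α ≤ T α) ∧ (∀ α, a α ∈ T α) ∧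
      ∀ α, IsBad (initialSup T α) →
        ∃ k y, IsBadSeq (initialSup T α) k y ∧ ∀ n, y n ∈ T α := by
  have hw : ∀ K : Submodule ℤ G, ∃ y : ℕ → G, IsBad K → ∃ k, IsBadSeq K k y := by
    intro K
    by_cases h : IsBad K
    · obtain ⟨k, y, hy⟩ := h
      exact ⟨y, fun _ => ⟨k, hy⟩⟩
    · exact ⟨0, fun h' => (h h').elim⟩
  choose w hw using hw
  let S : I → Submodule ℤ G → Submodule ℤ G := fun α K =>
    pureClosure (K ⊔ Submodule.span ℤ (insert (a α) (Set.range (w K))))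
  let T : I → Submodule ℤ G := (wellFounded_lt (α := I)).fix fun α rec =>
    S α (⨆ β : Set.Iio α, rec β β.2)
  have hT : ∀ α, T α = S α (⨆ β : Set.Iio α, T β) := fun α => WellFounded.fix_eq _ _ _
  have hS : ∀ α K, Submodule.span ℤ (insert (a α) (Set.range (w K))) ≤ S α K := fun α K =>
    le_sup_right.trans (le_pureClosure _)
  refine ⟨T, fun α => ?_, fun α => ?_, fun α => ?_, fun α => ?_, fun α hα => ?_⟩
  · rw [hT]; exact isPure_pureClosure _
  · induction α using WellFoundedLT.induction with
    | _ α ih =>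
      rw [hT]
      refine countable_pureClosure ?_
      have : Countable (Set.Iio α) := ((hI α).mono Set.Iio_subset_Iic_self).to_subtype
      have hc : (⋃ β : Set.Iio α, (T β : Set G)).Countable :=
        Set.countable_iUnion fun β => ih β β.2
      rw [Submodule.iSup_eq_span, ← Submodule.span_union]
      exact countable_span (hc.union ((Set.countable_range _).insert _))
  · exact (le_sup_left.trans (le_pureClosure _)).trans_eq (hT α).symm
  · rw [hT]
    exact hS _ _ (Submodule.subset_span (Set.mem_insert _ _))
  · obtain ⟨k, hk⟩ := hw _ hα
    refine ⟨k, _, hk, fun n => ?_⟩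
    rw [hT]
    exact hS _ _ (Submodule.subset_span (Set.mem_insert_of_mem _ ⟨n, rfl⟩))

section InitialSup

variable {G I : Type*} [AddCommGroup G] [LinearOrder I] {T : I → Submodule ℤ G}
  (hT : ∀ α, initialSup T α ≤ T α)

theorem le_initialSup {β α : I} (h : β < α) : T β ≤ initialSup T α :=
  le_iSup (fun β : Set.Iio α => T β) ⟨β, h⟩

include hT

theorem monotone_of_initialSup_le : Monotone T := by
  intro β α h
  rcases h.eq_or_lt with rfl | h
  · exact le_rfl
  · exact (le_initialSup h).trans (hT α)

theorem mem_initialSup {α : I} {x : G} : x ∈ initialSup T α ↔ x = 0 ∨ ∃ β < α, x ∈ T β := by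
  constructor
  · intro hx
    rcases isEmpty_or_nonempty (Set.Iio α) with h | h
    · rw [initialSup, iSup_of_empty] at hx
      exact Or.inl hx
    · have hdir : Directed (· ≤ ·) fun β : Set.Iio α => T β :=
        Monotone.directed_le fun β γ h => monotone_of_initialSup_le hT h
      obtain ⟨β, hβ⟩ := (Submodule.mem_iSup_of_directed _ hdir).1 hx
      exact Or.inr ⟨β, β.2, hβ⟩
  · rintro (rfl | ⟨β, hβ, hx⟩)
    · exact zero_mem _
    · exact le_initialSup hβ hx

theorem isPure_initialSup [Module.IsTorsionFree ℤ G] (hpure : ∀ α, IsPure (T α)) (α : I) :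
    IsPure (initialSup T α) := by
  intro m x hm hx
  rcases (mem_initialSup hT).1 hx with h | ⟨β, hβ, h⟩
  · rw [(smul_eq_zero.1 h).resolve_left hm]
    exact zero_mem _
  · exact le_initialSup hβ (hpure β m x hm h)

theorem monotone_initialSup : Monotone (initialSup T) := by
  intro β α h x hx
  rw [mem_initialSup hT] at hx ⊢
  exact hx.imp_right fun ⟨γ, hγ, hx⟩ => ⟨γ, hγ.trans_le h, hx⟩

/-- Along a closed set `D`, each element of the chain first appears right after some element of
`D`, unless it is present from the start. -/
theorem initialSup_continuous [WellFoundedLT I] {D : Set I}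
    (hD : ∀ s ⊆ D, s.Nonempty → ∀ a, IsLUB s a → a ∈ D) {α : I} {x : G}
    (hx : x ∈ initialSup T α) : (∀ δ ∈ D, x ∈ initialSup T δ) ∨
      ∃ β ∈ D, β < α ∧ ∀ δ ∈ D, β < δ → x ∈ initialSup T δ := by
  by_contra! ⟨⟨δ₀, hδ₀, hxδ₀⟩, hno⟩
  have hlt : ∀ δ, x ∉ initialSup T δ → δ < α := fun δ hδ => by
    by_contra! h
    exact hδ (monotone_initialSup hT h hx)
  let s : Set I := {δ ∈ D | x ∉ initialSup T δ}
  obtain ⟨σ, hσ, hmin⟩ := WellFounded.has_min (wellFounded_lt (α := I)) (upperBounds s)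
    ⟨α, fun δ hδ => (hlt δ hδ.2).le⟩
  have hlub : IsLUB s σ := ⟨hσ, fun b hb => not_lt.1 fun h => hmin b hb h⟩
  have hσD : σ ∈ D := hD s (fun δ hδ => hδ.1) ⟨δ₀, hδ₀, hxδ₀⟩ σ hlub
  by_cases hxσ : x ∈ initialSup T σ
  · rcases (mem_initialSup hT).1 hxσ with rfl | ⟨β, hβ, hxβ⟩
    · exact hxδ₀ (zero_mem _)
    · obtain ⟨δ, hδ, hβδ⟩ := (lt_isLUB_iff hlub).1 hβ
      exact hδ.2 (le_initialSup hβδ hxβ)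
  · obtain ⟨δ, hδ, hσδ, hxδ⟩ := hno σ hσD (hlt σ hxσ)
    exact (hσ ⟨hδ, hxδ⟩).not_gt hσδ

end InitialSup

end Filtrations

section Main

theorem ClosedUnder.of_isLUB {I : Type*} [LinearOrder I] {e : I → I} {s : Set I}
    (hs : ∀ δ ∈ s, ClosedUnder e δ) {a : I} (ha : IsLUB s a) : ClosedUnder e a := by
  intro β hβ
  obtain ⟨δ, hδ, hβδ⟩ := (lt_isLUB_iff ha).1 hβ
  exact (hs δ hδ β hβδ).trans_le (ha.1 hδ)

/-- The intersection of all stages of the chain with index in `D` beyond `γ`. -/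
def nextSup {G I : Type*} [AddCommGroup G] [LinearOrder I] (T : I → Submodule ℤ G) (D : Set I)
    (γ : I) : Submodule ℤ G :=
  ⨅ δ : {δ // δ ∈ D ∧ γ < δ}, initialSup T δ

variable {G I : Type*} [AddCommGroup G] [LinearOrder I] {T : I → Submodule ℤ G} {D : Set I}

theorem mem_nextSup {γ : I} {x : G} :
    x ∈ nextSup T D γ ↔ ∀ δ ∈ D, γ < δ → x ∈ initialSup T δ := by
  simp [nextSup, Submodule.mem_iInf]

theorem initialSup_le_nextSup (hT : ∀ α, initialSup T α ≤ T α) (γ : I) :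
    initialSup T γ ≤ nextSup T D γ := fun _ hx =>
  mem_nextSup.2 fun _ _ h => monotone_initialSup hT h.le hx

theorem countable_nextSup (hT : ∀ α, initialSup T α ≤ T α)
    (hcount : ∀ α, (T α : Set G).Countable) (hD : ∀ α, ∃ δ ∈ D, α < δ) (γ : I) :
    (nextSup T D γ : Set G).Countable := by
  obtain ⟨δ, hδ, h⟩ := hD γ
  exact (hcount δ).mono fun x hx => hT δ (mem_nextSup.1 hx δ hδ h)

variable [WellFoundedLT I]

/-- A subgroup covered by a filtration which is not bad along a closed unbounded set is free. -/
theorem free_of_club_not_isBad [Nonempty I] [Module.IsTorsionFree ℤ G]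
    (hT : ∀ α, initialSup T α ≤ T α)
    (hpure : ∀ α, IsPure (T α)) (hcount : ∀ α, (T α : Set G).Countable) {e : I → I}
    (he : ∀ α, ∃ δ, α < δ ∧ ClosedUnder e δ)
    (hbad : ∀ δ, ClosedUnder e δ → ¬ IsBad (initialSup T δ)) (N : Submodule ℤ G)
    (hN : ∀ x ∈ N, ∃ α, x ∈ T α) : Module.Free ℤ N := by
  let D : Set I := {δ | ClosedUnder e δ}
  have hDu : ∀ α, ∃ δ ∈ D, α < δ := fun α => (he α).imp fun δ h => ⟨h.2, h.1⟩
  obtain ⟨o, -, ho⟩ := WellFounded.has_min (wellFounded_lt (α := I)) Set.univ Set.univ_nonempty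
  have hoD : o ∈ D := fun β hβ => (ho β trivial hβ).elim
  refine free_of_forall_not_isBad (J := D) (K := fun δ => initialSup T δ)
    (K' := fun δ => nextSup T D δ) (fun α β h x hx => mem_nextSup.1 hx β β.2 h)
    (fun α x hx => ?_) (fun α => countable_nextSup hT hcount hDu α)
    (fun α => isPure_initialSup hT hpure α) (fun α => hbad α α.2) N fun x hx => ?_
  · rcases initialSup_continuous hT (fun s hs _ a ha => ClosedUnder.of_isLUB hs ha) hx with h | h
    · exact Or.inl (((mem_initialSup hT).1 (h o hoD)).resolve_right
        fun ⟨β, hβ, _⟩ => ho β trivial hβ)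
    · obtain ⟨β, hβ, hlt, h⟩ := h
      exact Or.inr ⟨⟨β, hβ⟩, hlt, mem_nextSup.2 h⟩
  · obtain ⟨α, hα⟩ := hN x hx
    obtain ⟨δ, hδ, hαδ⟩ := hDu α
    exact ⟨⟨δ, hδ⟩, initialSup_le_nextSup hT _ (le_initialSup hαδ hα)⟩

/-- If every character of `G` lifts to `ℚ`, a filtration which is bad along a closed unbounded set
of indices gives many subsets of that set. -/
theorem exists_injective_of_club_isBad [Nonempty I]
    (hW : ∀ χ : G →ₗ[ℤ] AddCircle (1 : ℚ), ∃ ψ : G →ₗ[ℤ] ℚ, ∀ x, (ψ x : AddCircle (1 : ℚ)) = χ x)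
    (hT : ∀ α, initialSup T α ≤ T α) (hcount : ∀ α, (T α : Set G).Countable)
    (hwit : ∀ α, IsBad (initialSup T α) →
      ∃ k y, IsBadSeq (initialSup T α) k y ∧ ∀ n, y n ∈ T α)
    (hD : ∀ s ⊆ D, s.Nonempty → ∀ a, IsLUB s a → a ∈ D) (hDu : ∀ α, ∃ δ ∈ D, α < δ)
    (hbad : ∀ δ ∈ D, IsBad (initialSup T δ)) :
    ∃ F : (D → Bool) → ℕ → Bool, Function.Injective F := by
  choose! k y hy hyT using fun δ (hδ : δ ∈ D) => hwit δ (hbad δ hδ)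
  choose θ hθK hθ using fun δ : D => (hy δ δ.2).exists_character
  obtain ⟨δ₀, hδ₀, -⟩ := hDu (Classical.arbitrary I)
  refine exists_injective_of_characters_no_lift (J := D) hW (K := fun δ => initialSup T δ)
    (K' := fun δ => nextSup T D δ) (fun α => initialSup_le_nextSup hT α)
    (fun α β h x hx => mem_nextSup.1 hx β β.2 h) (⨅ δ : D, initialSup T δ)
    ((hcount δ₀).mono fun x hx => hT δ₀ ((Submodule.mem_iInf _).1 hx ⟨δ₀, hδ₀⟩))
    (fun α x hx => ?_) (fun α => countable_nextSup hT hcount hDu α) θ hθK fun α ψ hψ => ?_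
  · rcases initialSup_continuous hT hD hx with h | h
    · exact Or.inl ((Submodule.mem_iInf _).2 fun δ => h δ δ.2)
    · obtain ⟨β, hβ, hlt, h⟩ := h
      exact Or.inr ⟨⟨β, hβ⟩, hlt, mem_nextSup.2 h⟩
  · obtain ⟨n, hn⟩ := hθ α ψ hψ
    exact ⟨y α n, mem_nextSup.2 fun δ hδ h => le_initialSup h (hyT α α.2 n), hn⟩

/-- A subgroup enumerated in type `ω₁` of a Borel coded group all of whose characters lift to `ℚ`
is free, provided that uncountable sets have more than `2 ^ ℵ₀` subsets. -/
theorem free_of_borelCode [Uncountable I] (hI : ∀ α : I, (Set.Iic α).Countable)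
    (hpow : ∀ D : Set I, ¬ D.Countable → ¬ ∃ F : (D → Bool) → ℕ → Bool, Function.Injective F)
    (code : BorelCode G)
    (hW : ∀ χ : G →ₗ[ℤ] AddCircle (1 : ℚ), ∃ ψ : G →ₗ[ℤ] ℚ, ∀ x, (ψ x : AddCircle (1 : ℚ)) = χ x)
    (N : Submodule ℤ G) (a : I → G) (hN : (N : Set G) ⊆ Set.range a) : Module.Free ℤ N := by
  have := isTorsionFree_of_lift hW
  obtain ⟨T, hpure, hcount, hT, haT, hwit⟩ := exists_filtration hI a
  have hu : ∀ β, ∃ v : ℕ → Cantor, (∀ n, v n ∈ code.Bstar) ∧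
      Set.range (fun n => code.q (v n)) = T β := by
    intro β
    obtain ⟨x, hx⟩ := (hcount β).exists_eq_range ⟨0, zero_mem _⟩
    choose v hv hvx using fun n => code.surj (x n)
    exact ⟨v, hv, by simp only [hvx, hx]⟩
  choose u huB huT using hu
  have hspan : ∀ (δ : I) (h : ℕ → I), Set.range h = Set.Iio δ →
      Submodule.span ℤ (Set.range fun p : ℕ × ℕ => code.q ((u ∘ h) p.1 p.2)) =
        initialSup T δ := by
    intro δ h hh
    refine le_antisymm (Submodule.span_le.2 ?_) (iSup_le fun β x hx => ?_)
    · rintro _ ⟨p, rfl⟩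
      have h1 : h p.1 ∈ Set.Iio δ := hh ▸ ⟨p.1, rfl⟩
      refine le_initialSup h1 ?_
      rw [← SetLike.mem_coe, ← huT]
      exact ⟨p.2, rfl⟩
    · obtain ⟨n, hn⟩ : (β : I) ∈ Set.range h := hh.symm.subset β.2
      rw [← SetLike.mem_coe, ← huT] at hx
      obtain ⟨m, rfl⟩ := hx
      exact Submodule.subset_span ⟨(n, m), by simp [hn]⟩
  rcases analytic_dichotomy hI (analyticSet_isBad code) u with ⟨e, he⟩ | ⟨e, he⟩
  · refine free_of_club_not_isBad hT hpure hcount (exists_closedUnder hI e) (fun δ hδ hb => ?_) N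
      fun x hx => ?_
    · rcases (Set.Iio δ).eq_empty_or_nonempty with h | h
      · obtain ⟨k, y, hy⟩ := hb
        obtain ⟨θ, hθK, hθ⟩ := hy.exists_character
        obtain ⟨ψ, hψ⟩ := hW θ
        obtain ⟨n, hn⟩ := hθ ψ fun x hx => by
          rcases (mem_initialSup hT).1 hx with rfl | ⟨β, hβ, -⟩
          · exact map_zero _
          · exact (h.subset hβ).elim
        exact hn (hψ _)
      · obtain ⟨g, hg⟩ := ((hI δ).mono Set.Iio_subset_Iic_self).exists_eq_range h
        refine he δ hδ ⟨g, hg.symm, fun n m => huB _ _, ?_⟩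
        rwa [hspan δ g hg.symm]
    · obtain ⟨α, rfl⟩ := hN hx
      exact ⟨α, haT α⟩
  · let D : Set I := {δ | ClosedUnder e δ ∧ (Set.Iio δ).Nonempty}
    have hDu : ∀ α, ∃ δ ∈ D, α < δ := fun α => by
      obtain ⟨δ, h, hδ⟩ := exists_closedUnder hI e α
      exact ⟨δ, ⟨hδ, α, h⟩, h⟩
    refine (hpow D (fun hc => ?_) (exists_injective_of_club_isBad hW hT hcount hwit ?_ hDu
      fun δ hδ => ?_)).elim
    · obtain ⟨b, hb⟩ := exists_strict_bound hI hc
      obtain ⟨δ, hδ, hbδ⟩ := hDu b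
      exact (hb δ hδ).asymm hbδ
    · rintro s hs ⟨δ, hδ⟩ σ hσ
      exact ⟨ClosedUnder.of_isLUB (fun δ hδ => (hs hδ).1) hσ,
        (hs hδ).2.mono (Set.Iio_subset_Iio (hσ.1 hδ))⟩
    · obtain ⟨g, hg, -, hb⟩ := he δ hδ.1 hδ.2
      rwa [hspan δ g hg] at hb

end Main

theorem BorelCode.small {B : Type u} [AddCommGroup B] (code : BorelCode B) : Small.{v} B :=
  small_of_surjective (f := code.q) fun b => (code.surj b).imp fun _ h => h.2

theorem not_exists_injective_of_lt_two_power_aleph_one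
    (hch : (2 : Cardinal.{u}) ^ aleph 0 < 2 ^ aleph 1) (X : Type) [Uncountable X] :
    ¬ ∃ F : (X → Bool) → ℕ → Bool, Function.Injective F := by
  rintro ⟨F, hF⟩
  have h0 : (2 : Cardinal.{0}) ^ aleph 0 < 2 ^ aleph 1 := by
    rw [← Cardinal.lift_lt.{0, u}]
    simpa using hch
  have h1 : aleph 1 ≤ #X := by
    rw [← succ_aleph0]
    exact Order.succ_le_of_lt Cardinal.aleph0_lt_mk
  have h2 := Cardinal.mk_le_of_injective hF
  rw [← Cardinal.power_def, ← Cardinal.power_def, mk_bool, mk_nat, ← aleph_zero] at h2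
  exact ((Cardinal.power_le_power_left two_ne_zero h1).trans h2).not_gt h0

/-- If `2 ^ ℵ₀ < 2 ^ ℵ₁`, then every Borel Whitehead group is ℵ₂-free. -/
theorem borel_whitehead_aleph2Free_of_wCH
    (hch : (2 : Cardinal) ^ Cardinal.aleph 0 < 2 ^ Cardinal.aleph 1)
    (B : Type*) [AddCommGroup B] (hcode : HasBorelCode B) (hwh : IsWhitehead B) :
    Aleph2Free B := by
  obtain ⟨code⟩ := hcode
  have := code.small
  intro K hK
  let I : Type := (aleph 1).ord.ToType
  have hmk : #I = aleph 1 := Cardinal.mk_ord_toType _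
  have : Uncountable I := by
    rw [← Cardinal.aleph0_lt_mk_iff, hmk]
    exact aleph0_lt_aleph_one
  have hI : ∀ α : I, (Set.Iic α).Countable := by
    intro α
    rw [← Set.Iio_insert]
    refine Set.Countable.insert _ (Set.countable_coe_iff.1 (Cardinal.mk_le_aleph0_iff.1 ?_))
    exact Order.lt_succ_iff.1 ((Cardinal.mk_Iio_lt α (by simp [I])).trans_eq
      (hmk.trans succ_aleph0.symm))
  obtain ⟨f⟩ : Nonempty (K ↪ I) := by
    rw [← Cardinal.lift_mk_le', hmk]
    simpa using hK
  have hfree := free_of_borelCode hI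
    (fun D hD => by
      have : Uncountable D := not_countable_iff.1 hD
      exact not_exists_injective_of_lt_two_power_aleph_one hch D)
    code hwh.exists_lift (AddSubgroup.toIntSubmodule K) (fun i => (Function.invFun f i : K).1)
    fun x hx => ⟨f ⟨x, hx⟩, congrArg Subtype.val (Function.leftInverse_invFun f.injective (⟨x, hx⟩ : K))⟩
  let e : AddSubgroup.toIntSubmodule K ≃+ K := AddEquiv.refl K
  exact Module.Free.of_equiv e.toIntLinearEquiv
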